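/- arXiv:math/9912134 — 4 statements merged into one kernel-verified Lean document; each statement's English description precedes it below -/
import Mathlib

section
/- Let T be a tree, let H₁ ⊆ H₂ be families of subtrees of T, and let ~ be a symmetric relation on H₂ containing the disjointness relation. Then mw(H₁, H₂, ~) = w(H₁, H₂, ~), where w(H₁, H₂, ~) is the minimal size of a ~-related subset of H₂ covering H₁, and mw(H₁, H₂, ~) is the maximum over all matchings M ⊆ H₁ of w(M, H₂, ~). -/
variable {V : Type*} [Fintype V] [DecidableEq V]

/-- `C` covers `H`: every edge of `H` meets some edge of `C`. -/
def Covers (C H : Finset (Finset V)) : Prop :=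
  ∀ e ∈ H, ∃ c ∈ C, (e ∩ c).Nonempty

/-- `C` is `r`-related: any two distinct members are related by `r`. -/
def RelatedFam (r : Finset V → Finset V → Prop) (C : Finset (Finset V)) : Prop :=
  ∀ x ∈ C, ∀ y ∈ C, x ≠ y → r x y

/-- A matching: pairwise disjoint edges. -/
def IsHypMatching (M : Finset (Finset V)) : Prop :=
  ∀ x ∈ M, ∀ y ∈ M, x ≠ y → Disjoint x y

/-- `w H₁ H₂ r`: minimal size of an `r`-related subset of `H₂` covering `H₁`. -/
noncomputable def w (H₁ H₂ : Finset (Finset V)) (r : Finset V → Finset V → Prop) : ℕ :=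
  sInf {n | ∃ C ⊆ H₂, RelatedFam r C ∧ Covers C H₁ ∧ C.card = n}

/-- `mw H₁ H₂ r`: maximum over matchings `M ⊆ H₁` of `w M H₂ r`. -/
noncomputable def mw (H₁ H₂ : Finset (Finset V)) (r : Finset V → Finset V → Prop) : ℕ :=
  sSup {n | ∃ M ⊆ H₁, IsHypMatching M ∧ w M H₂ r = n}

/-- `s` is a subtree of the tree `T`: nonempty and inducing a connected subgraph. -/
def IsSubtree (T : SimpleGraph V) (s : Finset V) : Prop :=
  s.Nonempty ∧ (T.induce (s : Set V)).Connected

theorem conn_closed (T : SimpleGraph V) (s : Finset V) (hs : IsSubtree T s) (Y : Set V)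
    (hY : ∀ a ∈ s, a ∈ Y → ∀ b ∈ s, T.Adj a b → b ∈ Y) (z : V) (hz : z ∈ s) (hzY : z ∈ Y) :
    ∀ y ∈ s, y ∈ Y := by
  intro y hy
  obtain ⟨p⟩ := hs.2.preconnected ⟨z, hz⟩ ⟨y, hy⟩
  have key : ∀ (a b : (s : Set V)) (_ : (T.induce (s : Set V)).Walk a b),
      (a : V) ∈ Y → (b : V) ∈ Y := by
    intro a b p
    induction p with
    | nil => exact id
    | cons h p ih =>
      intro ha
      exact ih (hY _ (Subtype.mem _) ha _ (Subtype.mem _) h)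
  exact key _ _ p hzY

/-- One step in `T` avoiding `w`. -/
def StepAv (T : SimpleGraph V) (w a b : V) : Prop := T.Adj a b ∧ a ≠ w ∧ b ≠ w

theorem stepAv_walk (T : SimpleGraph V) (w x a : V) (hx : x ≠ w)
    (h : Relation.ReflTransGen (StepAv T w) x a) :
    ∃ p : T.Walk x a, w ∉ p.support := by
  induction h with
  | refl => exact ⟨SimpleGraph.Walk.nil, by simpa using hx.symm⟩
  | tail _ h2 ih =>
    obtain ⟨p, hp⟩ := ih
    refine ⟨p.concat h2.1, ?_⟩
    rw [SimpleGraph.Walk.support_concat]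
    have := h2.2.2
    simp only [List.mem_append, List.mem_singleton, not_or]
    exact ⟨hp, this.symm⟩

theorem stepAv_ne (T : SimpleGraph V) (w x a : V) (hx : x ≠ w)
    (h : Relation.ReflTransGen (StepAv T w) x a) : a ≠ w := by
  induction h with
  | refl => exact hx
  | tail _ h2 _ => exact h2.2.2

theorem acyc_unique (T : SimpleGraph V) (hT : T.IsAcyclic) (w x a : V)
    (hwx : T.Adj w x) (hwa : T.Adj a w)
    (h : Relation.ReflTransGen (StepAv T w) x a) : a = x := by
  by_contra hne
  obtain ⟨p, hp⟩ := stepAv_walk T w x a hwx.ne' h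
  have hp' : w ∉ (p.toPath : T.Walk x a).support := fun hh =>
    hp (SimpleGraph.Walk.support_toPath_subset_support p hh)
  let q : T.Walk x a := SimpleGraph.Walk.cons hwx.symm (SimpleGraph.Walk.cons hwa.symm SimpleGraph.Walk.nil)
  have hq : q.IsPath := by
    have h1 := hwx.ne'
    have h2 := hwa.ne'
    simp [q, SimpleGraph.Walk.cons_isPath_iff, h1, h2, Ne.symm hne]
  have := (hT.subsingleton_path x a).elim p.toPath ⟨q, hq⟩
  rw [this] at hp'
  exact hp' (by simp [q])

/-- `X` hangs at `w`: the only vertex of `X` with neighbours outside is `w`. -/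
def Hang (T : SimpleGraph V) (X : Finset V) (w : V) : Prop :=
  ∀ a ∈ X, a ≠ w → ∀ b, T.Adj a b → b ∈ X

theorem avoid_main (T : SimpleGraph V) (hT : T.IsAcyclic)
    (H H₂ : Finset (Finset V)) (hsub : H ⊆ H₂)
    (htrees : ∀ s ∈ H₂, IsSubtree T s)
    (r : Finset V → Finset V → Prop)
    (hsymm : ∀ x y, r x y → r y x)
    (hdisj : ∀ x ∈ H₂, ∀ y ∈ H₂, Disjoint x y → r x y)
    (k : ℕ) (hk : ∀ D ⊆ H₂, RelatedFam r D → Covers D H → k ≤ D.card)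
    (C : Finset V → Finset (Finset V))
    (hC2 : ∀ e ∈ H, C e ⊆ H₂) (hCr : ∀ e ∈ H, RelatedFam r (C e))
    (hCc : ∀ e ∈ H, ∀ h ∈ H, h ≠ e → ∃ c ∈ C e, ∃ z ∈ c, z ∈ h)
    (hCd : ∀ e ∈ H, ∀ c ∈ C e, ∀ z ∈ c, z ∉ e)
    (hCk : ∀ e ∈ H, (C e).card < k) :
    ∀ (n : ℕ) (X : Finset V) (w : V), X.card ≤ n → w ∈ X → Hang T X w →
      ∀ i ∈ H, ∀ j ∈ H, i ≠ j → w ∈ i → w ∈ j → ∀ c ∈ C j, ∀ z ∈ c, z ∈ i → z ∉ X := by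
  classical
  intro n
  induction n with
  | zero =>
    intro X w hX hw
    have : X = ∅ := by simpa using hX
    simp [this] at hw
  | succ n ih =>
    intro X w hX hw hang i hi j hj hij hwi hwj c₀ hc₀ z₀ hz₀ hz₀i hz₀X
    let R := Relation.ReflTransGen (StepAv T w)
    have Rsymm : ∀ a b, R a b → R b a := by
      intro a b h
      induction h with
      | refl => exact Relation.ReflTransGen.refl
      | tail _ h2 ih' => exact Relation.ReflTransGen.head ⟨h2.1.symm, h2.2.2, h2.2.1⟩ ih'
    have RX : ∀ a b, R a b → a ≠ w → a ∈ X → b ∈ X := by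
      intro a b h haw ha
      induction h with
      | refl => exact ha
      | tail _ h2 ih' => exact hang _ ih' h2.2.1 _ h2.1
    let B : Set V := {z | z ≠ w ∧ ∃ x ∈ i, x ∈ X ∧ T.Adj w x ∧ R x z}
    -- subtrees avoiding `w` meeting `B` are contained in `B`
    have hB : ∀ s ∈ H₂, w ∉ s → ∀ z ∈ s, z ∈ B → ∀ y ∈ s, y ∈ B := by
      intro s hs hws
      intro z hz hzB
      refine conn_closed T s (htrees s hs) B ?_ z hz hzB
      rintro a ha ⟨haw, x, hxi, hxX, hwx, hR⟩ b hb hab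
      have hbw : b ≠ w := fun h => hws (h ▸ hb)
      exact ⟨hbw, x, hxi, hxX, hwx, hR.tail ⟨hab, haw, hbw⟩⟩
    -- members of `C i` in `B` avoid members of `H` through `w`
    have hav : ∀ h ∈ H, h ≠ i → w ∈ h → ∀ c ∈ C i, ∀ z ∈ c, z ∈ h → z ∉ B := by
      rintro h hh hne hwh c hc z hzc hzh ⟨hzw, x, hxi, hxX, hwx, hR⟩
      let Y : Finset V := Finset.univ.filter (fun a => R x a)
      have hYX : Y ⊂ X := by
        refine (Finset.ssubset_iff_of_subset ?_).2 ⟨w, hw, ?_⟩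
        · intro a ha
          exact RX x a (by simpa [Y] using ha) hwx.ne' hxX
        · intro hwY
          exact stepAv_ne T w x w hwx.ne' (by simpa [Y] using hwY) rfl
      have hwY : w ∉ Y := by
        intro hwY
        exact stepAv_ne T w x w hwx.ne' (by simpa [Y] using hwY) rfl
      have hxY : x ∈ Y := by
        simp only [Y, Finset.mem_filter, Finset.mem_univ, true_and]
        exact Relation.ReflTransGen.refl
      have hzY : z ∈ Y := by
        simp only [Y, Finset.mem_filter, Finset.mem_univ, true_and]
        exact hR
      have hYh : Hang T Y x := by
        intro a ha hax b hab
        have ha' : R x a := by simpa [Y] using ha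
        have haw : a ≠ w := stepAv_ne T w x a hwx.ne' ha'
        have hbw : b ≠ w := by
          rintro rfl
          exact hax (acyc_unique T hT b x a hwx hab ha')
        simp only [Y, Finset.mem_filter, Finset.mem_univ, true_and]
        exact ha'.tail ⟨hab, haw, hbw⟩
      have hxh : x ∈ h := by
        by_contra hxh
        refine hwY (conn_closed T h (htrees h (hsub hh)) (Y : Set V) ?_ z hzh hzY w hwh)
        intro a ha haY b _ hab
        exact hYh a haY (fun e => hxh (e ▸ ha)) b hab
      exact ih Y x (by have := Finset.card_lt_card hYX; omega) hxY hYh h hh i hi hne hxh hxi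
        c hc z hzc hzh hzY
    have hwC : ∀ e ∈ H, w ∈ e → ∀ c ∈ C e, w ∉ c := fun e he hwe c hc hwc => hCd e he c hc w hwc hwe
    have ne2 : ∀ s ∈ H₂, s.Nonempty := fun s hs => (htrees s hs).1
    let P : Finset V → Prop := fun c => ∀ y ∈ c, y ∈ B
    have hPn : ∀ e ∈ H, w ∈ e → ∀ c ∈ C e, ¬ P c → ∀ y ∈ c, y ∉ B := by
      intro e he hwe c hc hP y hy hyB
      exact hP (hB c (hC2 e he hc) (hwC e he hwe c hc) y hy hyB)
    let mix : Finset V → Finset V → Finset (Finset V) := fun a b =>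
      (C a).filter (fun c => ¬ P c) ∪ (C b).filter P
    have hmix2 : ∀ a ∈ H, ∀ b ∈ H, mix a b ⊆ H₂ := by
      intro a ha b hb c hc
      rcases Finset.mem_union.1 hc with h | h
      · exact hC2 a ha (Finset.mem_filter.1 h).1
      · exact hC2 b hb (Finset.mem_filter.1 h).1
    have hmixr : ∀ a ∈ H, ∀ b ∈ H, w ∈ a → w ∈ b → RelatedFam r (mix a b) := by
      intro a ha b hb hwa hwb
      have cross : ∀ x ∈ (C a).filter (fun c => ¬ P c), ∀ y ∈ (C b).filter P, r x y := by
        intro x hx y hy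
        rw [Finset.mem_filter] at hx hy
        refine hdisj x (hC2 a ha hx.1) y (hC2 b hb hy.1) ?_
        rw [Finset.disjoint_left]
        intro t htx hty
        exact hPn a ha hwa x hx.1 hx.2 t htx (hy.2 t hty)
      intro x hx y hy hxy
      rcases Finset.mem_union.1 hx with h | h <;> rcases Finset.mem_union.1 hy with h' | h'
      · exact hCr a ha x (Finset.mem_filter.1 h).1 y (Finset.mem_filter.1 h').1 hxy
      · exact cross x h y h'
      · exact hsymm _ _ (cross y h' x h)
      · exact hCr b hb x (Finset.mem_filter.1 h).1 y (Finset.mem_filter.1 h').1 hxy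
    have hmixc : ∀ a ∈ H, ∀ b ∈ H, w ∈ a → w ∈ b → ∀ h ∈ H, w ∉ h →
        ∃ c ∈ mix a b, (h ∩ c).Nonempty := by
      intro a ha b hb hwa hwb h hh hwh
      have hha : h ≠ a := fun e => hwh (e ▸ hwa)
      have hhb : h ≠ b := fun e => hwh (e ▸ hwb)
      by_cases hP : P h
      · obtain ⟨c, hc, z, hzc, hzh⟩ := hCc b hb h hh hhb
        refine ⟨c, Finset.mem_union_right _ (Finset.mem_filter.2 ⟨hc, ?_⟩),
          z, Finset.mem_inter.2 ⟨hzh, hzc⟩⟩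
        exact hB c (hC2 b hb hc) (hwC b hb hwb c hc) z hzc (hP z hzh)
      · obtain ⟨c, hc, z, hzc, hzh⟩ := hCc a ha h hh hha
        refine ⟨c, Finset.mem_union_left _ (Finset.mem_filter.2 ⟨hc, ?_⟩),
          z, Finset.mem_inter.2 ⟨hzh, hzc⟩⟩
        intro hPc
        exact hP (hB h (hsub hh) hwh z hzh (hPc z hzc))
    -- the complementary mix together with j is a related cover
    have h1 : k ≤ (insert j (mix j i)).card := by
      have hd : ∀ c ∈ mix j i, Disjoint j c := by
        intro c hc
        rw [Finset.disjoint_left]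
        intro t htj htc
        rcases Finset.mem_union.1 hc with h | h <;> rw [Finset.mem_filter] at h
        · exact hCd j hj c h.1 t htc htj
        · exact hav j hj hij.symm hwj c h.1 t htc htj (h.2 t htc)
      refine hk _ ?_ ?_ ?_
      · exact Finset.insert_subset (hsub hj) (hmix2 j hj i hi)
      · intro x hx y hy hxy
        rcases Finset.mem_insert.1 hx with rfl | hx <;> rcases Finset.mem_insert.1 hy with rfl | hy
        · exact absurd rfl hxy
        · exact hdisj _ (hsub hj) _ (hmix2 _ hj _ hi hy) (hd y hy)
        · exact hsymm _ _ (hdisj _ (hsub hj) _ (hmix2 _ hj _ hi hx) (hd x hx))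
        · exact hmixr j hj i hi hwj hwi x hx y hy hxy
      · intro h hh
        by_cases hwh : w ∈ h
        · exact ⟨j, Finset.mem_insert_self _ _, w, Finset.mem_inter.2 ⟨hwh, hwj⟩⟩
        · obtain ⟨c, hc, hn⟩ := hmixc j hj i hi hwj hwi h hh hwh
          exact ⟨c, Finset.mem_insert_of_mem hc, hn⟩
    have h2 : k ≤ (mix i j).card := by
      refine hk _ (hmix2 i hi j hj) (hmixr i hi j hj hwi hwj) ?_
      intro h hh
      by_cases hwh : w ∈ h
      · by_cases hhi : h = i
        · subst hhi
          refine ⟨c₀, Finset.mem_union_right _ (Finset.mem_filter.2 ⟨hc₀, ?_⟩),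
            z₀, Finset.mem_inter.2 ⟨hz₀i, hz₀⟩⟩
          have hz₀w : z₀ ≠ w := fun e => hwC j hj hwj c₀ hc₀ (e ▸ hz₀)
          refine hB c₀ (hC2 j hj hc₀) (hwC j hj hwj c₀ hc₀) z₀ hz₀ ⟨hz₀w, ?_⟩
          by_contra hcon
          push Not at hcon
          have := conn_closed T h (htrees h (hsub hh)) {a | a ≠ w ∧ R z₀ a} ?_ z₀ hz₀i
            ⟨hz₀w, Relation.ReflTransGen.refl⟩ w hwh
          · exact this.1 rfl
          · rintro a ha ⟨haw, hRa⟩ b hb hab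
            have hbw : b ≠ w := by
              rintro rfl
              exact hcon a ha (RX z₀ a hRa hz₀w hz₀X) hab.symm (Rsymm _ _ hRa)
            exact ⟨hbw, hRa.tail ⟨hab, haw, hbw⟩⟩
        · obtain ⟨c, hc, z, hzc, hzh⟩ := hCc i hi h hh hhi
          refine ⟨c, Finset.mem_union_left _ (Finset.mem_filter.2 ⟨hc, ?_⟩),
            z, Finset.mem_inter.2 ⟨hzh, hzc⟩⟩
          intro hPc
          exact hav h hh hhi hwh c hc z hzc hzh (hPc z hzc)
      · exact hmixc i hi j hj hwi hwj h hh hwh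
    have h3 := Finset.card_insert_le j (mix j i)
    have h4 : (mix j i).card ≤ ((C j).filter (fun c => ¬ P c)).card + ((C i).filter P).card :=
      Finset.card_union_le _ _
    have h5 : (mix i j).card ≤ ((C i).filter (fun c => ¬ P c)).card + ((C j).filter P).card :=
      Finset.card_union_le _ _
    have h6 := Finset.card_filter_add_card_filter_not (s := C i) P
    have h7 := Finset.card_filter_add_card_filter_not (s := C j) P
    have h8 := hCk i hi
    have h9 := hCk j hj
    omega

theorem exists_cover (H H₂ : Finset (Finset V)) (hsub : H ⊆ H₂)
    (hne : ∀ s ∈ H₂, s.Nonempty)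
    (r : Finset V → Finset V → Prop)
    (hdisj : ∀ x ∈ H₂, ∀ y ∈ H₂, Disjoint x y → r x y) :
    ∃ C ⊆ H₂, RelatedFam r C ∧ Covers C H ∧ C.card = w H H₂ r := by
  classical
  have hn : {n | ∃ C ⊆ H₂, RelatedFam r C ∧ Covers C H ∧ C.card = n}.Nonempty := by
    let S := H.powerset.filter (fun M => IsHypMatching M)
    have hS : S.Nonempty := ⟨∅, Finset.mem_filter.2 ⟨by simp, fun x hx => by simp at hx⟩⟩
    obtain ⟨M, hM, hmax⟩ := Finset.exists_max_image S Finset.card hS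
    simp only [S, Finset.mem_filter, Finset.mem_powerset] at hM hmax
    refine ⟨M.card, M, hM.1.trans hsub, ?_, ?_, rfl⟩
    · intro x hx y hy hxy
      exact hdisj x (hsub (hM.1 hx)) y (hsub (hM.1 hy)) (hM.2 x hx y hy hxy)
    · intro e he
      by_contra hcon
      push Not at hcon
      have hd : ∀ c ∈ M, Disjoint e c := fun c hc =>
        Finset.disjoint_iff_inter_eq_empty.2 (by simpa using hcon c hc)
      have heM : e ∉ M := by
        intro h
        have := hd e h
        rw [disjoint_self] at this
        exact (hne e (hsub he)).ne_empty this
      have := hmax (insert e M) ⟨Finset.insert_subset he hM.1, by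
        intro x hx y hy hxy
        rcases Finset.mem_insert.1 hx with hx1 | hx1 <;>
          rcases Finset.mem_insert.1 hy with hy1 | hy1
        · exact absurd (hx1.trans hy1.symm) hxy
        · exact hx1 ▸ hd y hy1
        · exact hy1 ▸ (hd x hx1).symm
        · exact hM.2 x hx1 y hy1 hxy⟩
      rw [Finset.card_insert_of_notMem heM] at this
      omega
  exact Nat.sInf_mem hn

theorem w_le_card (H H₂ : Finset (Finset V)) (r : Finset V → Finset V → Prop)
    (D : Finset (Finset V)) (h2 : D ⊆ H₂) (hr : RelatedFam r D) (hc : Covers D H) :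
    w H H₂ r ≤ D.card :=
  Nat.sInf_le ⟨D, h2, hr, hc, rfl⟩

theorem stmt1 (T : SimpleGraph V) (hT : T.IsTree)
    (H₁ H₂ : Finset (Finset V)) (hsub : H₁ ⊆ H₂)
    (htrees : ∀ s ∈ H₂, IsSubtree T s)
    (r : Finset V → Finset V → Prop)
    (hsymm : ∀ x y, r x y → r y x)
    (hdisj : ∀ x ∈ H₂, ∀ y ∈ H₂, Disjoint x y → r x y) :
    mw H₁ H₂ r = w H₁ H₂ r := by
  classical
  have ne2 : ∀ s ∈ H₂, s.Nonempty := fun s hs => (htrees s hs).1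
  have hub : ∀ n ∈ {n | ∃ M ⊆ H₁, IsHypMatching M ∧ w M H₂ r = n}, n ≤ w H₁ H₂ r := by
    rintro n ⟨M, hM, -, rfl⟩
    obtain ⟨C, h2, hr, hc, hcard⟩ := exists_cover H₁ H₂ hsub ne2 r hdisj
    rw [← hcard]
    exact w_le_card M H₂ r C h2 hr (fun e he => hc e (hM he))
  let S := H₁.powerset.filter (fun H => w H₁ H₂ r ≤ w H H₂ r)
  have hS : S.Nonempty := ⟨H₁, by simp [S]⟩
  obtain ⟨H, hH, hmin⟩ := Finset.exists_min_image S Finset.card hS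
  simp only [S, Finset.mem_filter, Finset.mem_powerset] at hH hmin
  obtain ⟨hH1, hHw⟩ := hH
  have hHk : ∀ D ⊆ H₂, RelatedFam r D → Covers D H → w H₁ H₂ r ≤ D.card :=
    fun D a b c => hHw.trans (w_le_card H H₂ r D a b c)
  have hC : ∀ e, ∃ C : Finset (Finset V), e ∈ H →
      C ⊆ H₂ ∧ RelatedFam r C ∧ Covers C (H.erase e) ∧ C.card < w H₁ H₂ r := by
    intro e
    by_cases he : e ∈ H
    · obtain ⟨C, h2, hr, hc, hcard⟩ := exists_cover (H.erase e) H₂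
        ((Finset.erase_subset _ _).trans (hH1.trans hsub)) ne2 r hdisj
      refine ⟨C, fun _ => ⟨h2, hr, hc, ?_⟩⟩
      by_contra hlt
      have := hmin (H.erase e) ⟨(Finset.erase_subset _ _).trans hH1, by omega⟩
      have := Finset.card_erase_lt_of_mem he
      omega
    · exact ⟨∅, fun h => absurd h he⟩
  choose C hC using hC
  have hCc : ∀ e ∈ H, ∀ h ∈ H, h ≠ e → ∃ c ∈ C e, ∃ z ∈ c, z ∈ h := by
    intro e he h hh hne
    obtain ⟨c, hc, z, hz⟩ := (hC e he).2.2.1 h (Finset.mem_erase.2 ⟨hne, hh⟩)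
    rw [Finset.mem_inter] at hz
    exact ⟨c, hc, z, hz.2, hz.1⟩
  have hCd : ∀ e ∈ H, ∀ c ∈ C e, ∀ z ∈ c, z ∉ e := by
    intro e he c hc z hz hze
    obtain ⟨h2, hr, hcov, hlt⟩ := hC e he
    have := hHk (C e) h2 hr (by
      intro h hh
      by_cases hhe : h = e
      · subst hhe
        exact ⟨c, hc, z, Finset.mem_inter.2 ⟨hze, hz⟩⟩
      · exact hcov h (Finset.mem_erase.2 ⟨hhe, hh⟩))
    omega
  have hmatch : IsHypMatching H := by
    intro i hi j hj hij
    rw [Finset.disjoint_left]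
    intro v hvi hvj
    obtain ⟨c, hc, z, hzc, hzi⟩ := hCc j hj i hi hij
    exact avoid_main T hT.isAcyclic H H₂ (hH1.trans hsub) htrees r hsymm hdisj (w H₁ H₂ r) hHk C
      (fun e he => (hC e he).1) (fun e he => (hC e he).2.1) hCc hCd
      (fun e he => (hC e he).2.2.2) _ Finset.univ v le_rfl (Finset.mem_univ _)
      (fun _ _ _ _ _ => Finset.mem_univ _) i hi j hj hij hvi hvj c hc z hzc hzi
      (Finset.mem_univ _)
  apply le_antisymm
  · exact csSup_le ⟨_, H, hH1, hmatch, rfl⟩ hub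
  · exact hHw.trans (le_csSup ⟨_, hub⟩ ⟨H, hH1, hmatch, rfl⟩)
end

section
/- Let H be a family of subtrees of a fixed tree T. Then the matching width of H equals the width of H: mw(H) = w(H). -/
variable {V : Type*} [Fintype V] [DecidableEq V]

/-- Minimal size of a subset of `H` covering `H'`. -/
noncomputable def coverNum (H' H : Finset (Finset V)) : ℕ :=
  sInf {n | ∃ C ⊆ H, Covers C H' ∧ C.card = n}

/-- The width `w(H)`. -/
noncomputable def width (H : Finset (Finset V)) : ℕ := coverNum H H

/-- The matching width `mw(H)`. -/
noncomputable def matchingWidth (H : Finset (Finset V)) : ℕ :=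
  sSup {n | ∃ M ⊆ H, IsHypMatching M ∧ coverNum M H = n}

/-- `t` is the top of the convex set `s` in a tree order. -/
def TopOf {W : Type*} (le : W → W → Prop) (t : W) (s : Finset W) : Prop :=
  t ∈ s ∧ ∀ x ∈ s, le t x ∧ ∀ z, le t z → le z x → z ∈ s

theorem topOf_mem {W : Type*} {le : W → W → Prop}
    (htr : ∀ a b c, le a b → le b c → le a c)
    {t : W} {s : Finset W} (h : TopOf le t s) {v w z : W}
    (hv : v ∈ s) (hz : z ∈ s) (hvw : le v w) (hwz : le w z) : w ∈ s :=
  (h.2 z hz).2 w (htr _ _ _ (h.2 v hv).1 hvw) hwz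

theorem component_top {W : Type*} [Finite W] [DecidableEq W] (le : W → W → Prop)
    (hrefl : ∀ a, le a a)
    (htr : ∀ a b c, le a b → le b c → le a c)
    (hanti : ∀ a b, le a b → le b a → a = b)
    (hch : ∀ u v x, le u x → le v x → le u v ∨ le v u)
    (F : Finset W → Prop) (hF : ∀ f, F f → ∃ t, TopOf le t f)
    (g : Finset W) (hg : F g) :
    ∃ f w, F f ∧ Relation.ReflTransGen
        (fun f g : Finset W => F f ∧ F g ∧ (f ∩ g).Nonempty) g f ∧ w ∈ f ∧
      ∀ h, Relation.ReflTransGen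
        (fun f g : Finset W => F f ∧ F g ∧ (f ∩ g).Nonempty) g h → ∀ z ∈ h, le w z := by
  set R := (fun f g : Finset W => F f ∧ F g ∧ (f ∩ g).Nonempty) with hR
  have hsymm : ∀ f h, Relation.ReflTransGen R f h → Relation.ReflTransGen R h f := by
    intro f h hfh
    induction hfh with
    | refl => exact Relation.ReflTransGen.refl
    | tail _ h2 ih =>
      exact Relation.ReflTransGen.head ⟨h2.2.1, h2.1, by rw [Finset.inter_comm]; exact h2.2.2⟩ ih
  have hFR : ∀ h, Relation.ReflTransGen R g h → F h := by
    intro h hh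
    cases hh with
    | refl => exact hg
    | tail _ h2 => exact h2.2.1
  let P : PartialOrder W :=
    { le := le, le_refl := hrefl, le_trans := htr, le_antisymm := hanti }
  let S : Set W := {w | ∃ f, Relation.ReflTransGen R g f ∧ TopOf le w f}
  have hne : S.Nonempty := by
    obtain ⟨t, ht⟩ := hF g hg
    exact ⟨t, g, Relation.ReflTransGen.refl, ht⟩
  obtain ⟨w, hw⟩ := (Set.toFinite S).exists_minimal hne
  obtain ⟨f, hgf, hwf⟩ := hw.1
  refine ⟨f, w, hFR f hgf, hgf, hwf.1, ?_⟩
  have key : ∀ h, Relation.ReflTransGen R f h → ∀ z ∈ h, le w z := by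
    intro h hfh
    induction hfh with
    | refl => exact fun z hz => (hwf.2 z hz).1
    | @tail b c h1 h2 ih =>
      intro z hz
      obtain ⟨t, ht⟩ := hF c h2.2.1
      obtain ⟨y, hy⟩ := h2.2.2
      rw [Finset.mem_inter] at hy
      have hwy := ih y hy.1
      have hty := (ht.2 y hy.2).1
      have htS : t ∈ S := ⟨c, (hgf.trans h1).tail h2, ht⟩
      have : le w t := by
        rcases hch w t y hwy hty with h | h
        · exact h
        · exact hw.2 htS h
      exact htr _ _ _ this (ht.2 z hz).1
  intro h hh
  exact key h ((hsymm _ _ hgf).trans hh)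

theorem main_exchange {W : Type*} [Fintype W] [DecidableEq W] (le : W → W → Prop)
    (hrefl : ∀ a, le a a)
    (htr : ∀ a b c, le a b → le b c → le a c)
    (hanti : ∀ a b, le a b → le b a → a = b)
    (hch : ∀ u v x, le u x → le v x → le u v ∨ le v u)
    (H : Finset (Finset W)) (hH : ∀ s ∈ H, ∃ t, TopOf le t s)
    (A : Finset (Finset W)) (hAH : A ⊆ H) (n : ℕ)
    (hn : ∀ C ⊆ H, Covers C A → n ≤ C.card)
    (hmin : ∀ x ∈ A, ∃ C ⊆ H, Covers C (A.erase x) ∧ C.card < n)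
    (a a' : Finset W) (ha : a ∈ A) (ha' : a' ∈ A) (hne : a ≠ a') (v : W)
    (hv : TopOf le v a') (hva : v ∈ a)
    (hY : ∀ y ∈ A, (∀ u ∈ y, le v u) → v ∉ y → ¬ (y ∩ a').Nonempty) : False := by
  classical
  obtain ⟨D, hDH, hDc, hDn⟩ := hmin a' ha'
  obtain ⟨E, hEH, hEc, hEn⟩ := hmin a ha
  have hDa : ∀ d ∈ D, ¬ (a' ∩ d).Nonempty := by
    intro d hd h
    have : Covers D A := by
      intro x hx
      by_cases hxa : x = a'
      · subst hxa; exact ⟨d, hd, h⟩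
      · exact hDc x (Finset.mem_erase.2 ⟨hxa, hx⟩)
    have := hn D hDH this
    omega
  have hEa : ∀ d ∈ E, ¬ (a ∩ d).Nonempty := by
    intro d hd h
    have : Covers E A := by
      intro x hx
      by_cases hxa : x = a
      · subst hxa; exact ⟨d, hd, h⟩
      · exact hEc x (Finset.mem_erase.2 ⟨hxa, hx⟩)
    have := hn E hEH this
    omega
  have hDv : ∀ d ∈ D, v ∉ d := fun d hd h => hDa d hd ⟨v, Finset.mem_inter.2 ⟨hv.1, h⟩⟩
  have hEv : ∀ d ∈ E, v ∉ d := fun d hd h => hEa d hd ⟨v, Finset.mem_inter.2 ⟨hva, h⟩⟩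
  have hbelow : ∀ f ∈ H, v ∉ f → ∀ u ∈ f, le v u → ∀ u ∈ f, le v u := by
    intro f hf hvf u hu hvu u' hu'
    obtain ⟨t, ht⟩ := hH f hf
    rcases hch t v u (ht.2 u hu).1 hvu with h | h
    · exact absurd ((ht.2 u hu).2 v h hvu) hvf
    · exact htr _ _ _ h (ht.2 u' hu').1
  let F : Finset W → Prop := fun f => (f ∈ D ∨ f ∈ E ∨ f ∈ A) ∧ (∀ u ∈ f, le v u) ∧ v ∉ f
  have hFH : ∀ f, F f → f ∈ H := by
    rintro f ⟨h | h | h, _⟩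
    · exact hDH h
    · exact hEH h
    · exact hAH h
  let R := (fun f g : Finset W => F f ∧ F g ∧ (f ∩ g).Nonempty)
  let In : Finset W → Prop := fun f => F f ∧ ∃ g, F g ∧ (g ∩ a').Nonempty ∧
    Relation.ReflTransGen R g f
  -- an element meeting an `In` element and avoiding `v` is `In`
  have hIn : ∀ f h, In f → (h ∈ D ∨ h ∈ E ∨ h ∈ A) → v ∉ h → (f ∩ h).Nonempty → In h := by
    intro f h hf hh hvh hfh
    have hhH : h ∈ H := by
      rcases hh with h | h | h
      · exact hDH h
      · exact hEH h
      · exact hAH h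
    obtain ⟨u, hu⟩ := hfh
    have hu' := Finset.mem_inter.1 hu
    have hFh : F h := ⟨hh, hbelow h hhH hvh u hu'.2 (hf.1.2.1 u hu'.1), hvh⟩
    obtain ⟨hFf, g, hg1, hg2, hg3⟩ := hf
    exact ⟨hFh, g, hg1, hg2, hg3.tail ⟨hFf, hFh, u, hu⟩⟩
  have hcD : (D.filter In).card + (D.filter (fun f => ¬ In f)).card = D.card :=
    Finset.card_filter_add_card_filter_not _
  have hcE : (E.filter In).card + (E.filter (fun f => ¬ In f)).card = E.card :=
    Finset.card_filter_add_card_filter_not _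
  by_cases hcard : (E.filter In).card ≤ (D.filter In).card
  · have hcov : Covers (D.filter (fun f => ¬ In f) ∪ E.filter In) A := by
      intro x hx
      by_cases hxa : x = a'
      · subst hxa
        obtain ⟨e, he, u, hu⟩ := hEc x (Finset.mem_erase.2 ⟨hne.symm, hx⟩)
        have hu' := Finset.mem_inter.1 hu
        have hFe : F e := ⟨Or.inr (Or.inl he),
          hbelow e (hEH he) (hEv e he) u hu'.2 (hv.2 u hu'.1).1, hEv e he⟩
        refine ⟨e, Finset.mem_union_right _ (Finset.mem_filter.2 ⟨he, hFe, e, hFe, ?_,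
          Relation.ReflTransGen.refl⟩), u, hu⟩
        rw [Finset.inter_comm]; exact ⟨u, hu⟩
      · obtain ⟨d, hd, hxd⟩ := hDc x (Finset.mem_erase.2 ⟨hxa, hx⟩)
        by_cases hId : In d
        · by_cases hvx : v ∈ x
          · obtain ⟨hFd, g, hFg, hga, hgd⟩ := hId
            obtain ⟨f, w, hFf, hgf, hwf, hw⟩ := component_top le hrefl htr hanti hch F
              (fun f hf => hH f (hFH f hf)) g hFg
            have hvw : le v w := hFf.2.1 w hwf
            have hwa : w ∈ a' := by
              obtain ⟨z, hz⟩ := hga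
              have hz' := Finset.mem_inter.1 hz
              exact topOf_mem htr hv hv.1 hz'.2 hvw (hw g Relation.ReflTransGen.refl z hz'.1)
            have hwx : w ∈ x := by
              obtain ⟨z, hz⟩ := hxd
              have hz' := Finset.mem_inter.1 hz
              obtain ⟨t, ht⟩ := hH x (hAH hx)
              exact topOf_mem htr ht hvx hz'.1 hvw (hw d hgd z hz'.2)
            rcases hFf.1 with h | h | h
            · exact absurd ⟨w, Finset.mem_inter.2 ⟨hwa, hwf⟩⟩ (hDa f h)
            · exact ⟨f, Finset.mem_union_right _ (Finset.mem_filter.2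
                ⟨h, hFf, g, hFg, hga, hgf⟩), w, Finset.mem_inter.2 ⟨hwx, hwf⟩⟩
            · exact absurd ⟨w, Finset.mem_inter.2 ⟨hwf, hwa⟩⟩ (hY f h hFf.2.1 hFf.2.2)
          · have hIx : In x := hIn d x hId (Or.inr (Or.inr hx)) hvx
              (by rw [Finset.inter_comm]; exact hxd)
            have hxa2 : x ≠ a := fun h => hvx (h ▸ hva)
            obtain ⟨e, he, hxe⟩ := hEc x (Finset.mem_erase.2 ⟨hxa2, hx⟩)
            exact ⟨e, Finset.mem_union_right _ (Finset.mem_filter.2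
              ⟨he, hIn x e hIx (Or.inr (Or.inl he)) (hEv e he) hxe⟩), hxe⟩
        · exact ⟨d, Finset.mem_union_left _ (Finset.mem_filter.2 ⟨hd, hId⟩), hxd⟩
    have h1 := hn _ (Finset.union_subset ((Finset.filter_subset _ _).trans hDH)
      ((Finset.filter_subset _ _).trans hEH)) hcov
    have h2 := Finset.card_union_le (D.filter (fun f => ¬ In f)) (E.filter In)
    omega
  · have hcov : Covers (insert a' (E.filter (fun f => ¬ In f) ∪ D.filter In)) A := by
      intro x hx
      by_cases hvx : v ∈ x
      · exact ⟨a', Finset.mem_insert_self _ _, v, Finset.mem_inter.2 ⟨hvx, hv.1⟩⟩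
      · have hxa2 : x ≠ a := fun h => hvx (h ▸ hva)
        have hxa : x ≠ a' := fun h => hvx (h ▸ hv.1)
        obtain ⟨e, he, hxe⟩ := hEc x (Finset.mem_erase.2 ⟨hxa2, hx⟩)
        by_cases hIe : In e
        · have hIx : In x := hIn e x hIe (Or.inr (Or.inr hx)) hvx
            (by rw [Finset.inter_comm]; exact hxe)
          obtain ⟨d, hd, hxd⟩ := hDc x (Finset.mem_erase.2 ⟨hxa, hx⟩)
          exact ⟨d, Finset.mem_insert_of_mem (Finset.mem_union_right _ (Finset.mem_filter.2
              ⟨hd, hIn x d hIx (Or.inl hd) (hDv d hd) hxd⟩)), hxd⟩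
        · exact ⟨e, Finset.mem_insert_of_mem (Finset.mem_union_left _
            (Finset.mem_filter.2 ⟨he, hIe⟩)), hxe⟩
    have h1 := hn _ (Finset.insert_subset (hAH ha')
      (Finset.union_subset ((Finset.filter_subset _ _).trans hEH)
      ((Finset.filter_subset _ _).trans hDH))) hcov
    have h2 := Finset.card_union_le (E.filter (fun f => ¬ In f)) (D.filter In)
    have h3 := Finset.card_insert_le a' (E.filter (fun f => ¬ In f) ∪ D.filter In)
    omega

theorem minimal_isMatching {W : Type*} [Fintype W] [DecidableEq W] (le : W → W → Prop)
    (hrefl : ∀ a, le a a)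
    (htr : ∀ a b c, le a b → le b c → le a c)
    (hanti : ∀ a b, le a b → le b a → a = b)
    (hch : ∀ u v x, le u x → le v x → le u v ∨ le v u)
    (H : Finset (Finset W)) (hH : ∀ s ∈ H, ∃ t, TopOf le t s)
    (A : Finset (Finset W)) (hAH : A ⊆ H) (n : ℕ)
    (hn : ∀ C ⊆ H, Covers C A → n ≤ C.card)
    (hmin : ∀ x ∈ A, ∃ C ⊆ H, Covers C (A.erase x) ∧ C.card < n) :
    IsHypMatching A := by
  let P : PartialOrder W :=
    { le := le, le_refl := hrefl, le_trans := htr, le_antisymm := hanti }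
  let S : Set W := {v | ∃ a ∈ A, ∃ a' ∈ A, a ≠ a' ∧ TopOf le v a' ∧ v ∈ a}
  -- two meeting sets: the top of one lies in the other
  have hmeet : ∀ a ∈ A, ∀ a' ∈ A, (a ∩ a').Nonempty → ∃ t t', TopOf le t a ∧ TopOf le t' a' ∧
      (t' ∈ a ∨ t ∈ a') := by
    intro a ha a' ha' h
    obtain ⟨z, hz⟩ := h
    have hz' := Finset.mem_inter.1 hz
    obtain ⟨t, ht⟩ := hH a (hAH ha)
    obtain ⟨t', ht'⟩ := hH a' (hAH ha')
    refine ⟨t, t', ht, ht', ?_⟩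
    rcases hch t t' z (ht.2 z hz'.1).1 (ht'.2 z hz'.2).1 with h | h
    · exact Or.inl ((ht.2 z hz'.1).2 t' h (ht'.2 z hz'.2).1)
    · exact Or.inr ((ht'.2 z hz'.2).2 t h (ht.2 z hz'.1).1)
  by_contra hcon
  have hSne : S.Nonempty := by
    unfold IsHypMatching at hcon
    push Not at hcon
    obtain ⟨x, hx, y, hy, hxy, hd⟩ := hcon
    rw [Finset.disjoint_iff_inter_eq_empty, ← ne_eq, ← Finset.nonempty_iff_ne_empty] at hd
    obtain ⟨t, t', ht, ht', h | h⟩ := hmeet x hx y hy hd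
    · exact ⟨t', x, hx, y, hy, hxy, ht', h⟩
    · exact ⟨t, y, hy, x, hx, hxy.symm, ht, h⟩
  obtain ⟨v, hv⟩ := (Set.toFinite S).exists_maximal hSne
  obtain ⟨a, ha, a', ha', hne, hva', hva⟩ := hv.1
  refine main_exchange le hrefl htr hanti hch H hH A hAH n hn hmin a a' ha ha' hne v hva' hva ?_
  intro y hy hby hvy hya
  have hya' : y ≠ a' := fun h => hvy (h ▸ hva'.1)
  obtain ⟨z, hz⟩ := hya
  have hz' := Finset.mem_inter.1 hz
  obtain ⟨t, ht⟩ := hH y (hAH hy)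
  have hvt : le v t := hby t ht.1
  have hta : t ∈ a' := topOf_mem htr hva' hva'.1 hz'.2 hvt (ht.2 z hz'.1).1
  have htS : t ∈ S := ⟨a', ha', y, hy, hya'.symm, ht, hta⟩
  have : le t v := hv.2 htS hvt
  exact hvy (hanti _ _ hvt this ▸ ht.1)

/-- The tree order. -/
theorem exists_tree_order (T : SimpleGraph V) (hT : T.IsTree) :
    ∃ le : V → V → Prop, (∀ a, le a a) ∧ (∀ a b c, le a b → le b c → le a c) ∧
      (∀ a b, le a b → le b a → a = b) ∧
      (∀ u v x, le u x → le v x → le u v ∨ le v u) ∧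
      (∀ x y, T.Adj x y → (∀ z, le z y ↔ le z x ∨ z = y) ∨ (∀ z, le z x ↔ le z y ∨ z = x)) := by
  obtain ⟨r⟩ := hT.connected.nonempty
  have hex : ∀ x, ∃ p : T.Walk r x, p.IsPath ∧ ∀ q : T.Walk r x, q.IsPath → q = p := by
    intro x
    obtain ⟨p, hp, hq⟩ := hT.existsUnique_path r x
    exact ⟨p, hp, hq⟩
  choose P hP hU using hex
  have htake : ∀ u x (h : u ∈ (P x).support), (P x).takeUntil u h = P u :=
    fun u x h => hU u _ ((hP x).takeUntil h)
  have htr : ∀ a b c, a ∈ (P b).support → b ∈ (P c).support → a ∈ (P c).support := by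
    intro a b c hab hbc
    rw [← htake b c hbc] at hab
    exact SimpleGraph.Walk.support_takeUntil_subset_support _ hbc hab
  have hlen : ∀ a b, a ∈ (P b).support → a ≠ b → (P a).length < (P b).length := by
    intro a b hab hne
    rw [← htake a b hab]
    exact SimpleGraph.Walk.length_takeUntil_lt_length hab hne
  have hanti : ∀ a b, a ∈ (P b).support → b ∈ (P a).support → a = b := by
    intro a b h1 h2
    by_contra hne
    have := hlen a b h1 hne
    have := hlen b a h2 (Ne.symm hne)
    omega
  have hadj : ∀ x y, T.Adj x y → y ∉ (P x).support →
      ∀ z, z ∈ (P y).support ↔ z ∈ (P x).support ∨ z = y := by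
    intro x y hxy hy z
    have : (P x).concat hxy = P y := hU y _ ((hP x).concat hy hxy)
    rw [← this, SimpleGraph.Walk.support_concat]
    simp
  refine ⟨fun u x => u ∈ (P x).support, fun a => SimpleGraph.Walk.end_mem_support _, htr, hanti,
    ?_, ?_⟩
  · intro u v x hu hv
    have h := hu
    rw [← SimpleGraph.Walk.take_spec (P x) hv, SimpleGraph.Walk.mem_support_append_iff] at h
    by_cases hvu : v ∈ (P u).support
    · exact Or.inr hvu
    · left
      have h2 := hv
      by_contra huv
      rcases h with h | h
      · rw [htake] at h; exact huv h
      · -- P v followed by the piece from v to u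
        have hp : ((P x).dropUntil v hv).IsPath := (hP x).dropUntil hv
        have h3 : (((P x).takeUntil v hv).append
            (((P x).dropUntil v hv).takeUntil u h)).IsPath := by
          have := hP x
          rw [← SimpleGraph.Walk.take_spec (P x) hv,
            ← SimpleGraph.Walk.take_spec ((P x).dropUntil v hv) h,
            SimpleGraph.Walk.append_assoc] at this
          exact this.of_append_left
        have h4 := hU u _ h3
        apply hvu
        rw [← h4, SimpleGraph.Walk.mem_support_append_iff]
        left
        exact SimpleGraph.Walk.end_mem_support _
  · intro x y hxy
    by_cases hy : y ∈ (P x).support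
    · right
      have hx : x ∉ (P y).support := fun h => hxy.ne (hanti _ _ h hy)
      exact hadj y x hxy.symm hx
    · left
      exact hadj x y hxy hy

theorem subtree_top (T : SimpleGraph V) (le : V → V → Prop)
    (hrefl : ∀ a, le a a)
    (htr : ∀ a b c, le a b → le b c → le a c)
    (hanti : ∀ a b, le a b → le b a → a = b)
    (hadj : ∀ x y, T.Adj x y →
      (∀ z, le z y ↔ le z x ∨ z = y) ∨ (∀ z, le z x ↔ le z y ∨ z = x))
    (s : Finset V) (hs : IsSubtree T s) : ∃ t, TopOf le t s := by
  let P : PartialOrder V :=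
    { le := le, le_refl := hrefl, le_trans := htr, le_antisymm := hanti }
  obtain ⟨t, ht⟩ := (Set.toFinite (s : Set V)).exists_minimal hs.1
  have hts : t ∈ s := ht.1
  refine ⟨t, hts, ?_⟩
  have key : ∀ x : (s : Set V), Relation.ReflTransGen (T.induce (s : Set V)).Adj ⟨t, hts⟩ x →
      le t x ∧ ∀ z, le t z → le z x → z ∈ s := by
    intro x hx
    induction hx with
    | refl => exact ⟨hrefl t, fun z h1 h2 => hanti _ _ h1 h2 ▸ hts⟩
    | @tail b c h1 h2 ih =>
      have hbc : T.Adj b c := h2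
      have hcs : (c : V) ∈ s := c.2
      rcases hadj b c hbc with h | h
      · refine ⟨htr _ _ _ ih.1 ((h _).2 (Or.inl (hrefl _))), ?_⟩
        intro z hz1 hz2
        rcases (h z).1 hz2 with h' | h'
        · exact ih.2 z hz1 h'
        · exact h' ▸ hcs
      · have hcb : le c b := (h _).2 (Or.inl (hrefl _))
        refine ⟨?_, fun z hz1 hz2 => ih.2 z hz1 (htr _ _ _ hz2 hcb)⟩
        rcases (h t).1 ih.1 with h' | h'
        · exact h'
        · rw [← h'] at hcb
          exact ht.2 hcs hcb
  intro x hx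
  exact key ⟨x, hx⟩ ((SimpleGraph.reachable_iff_reflTransGen _ _).1
    (hs.2.preconnected ⟨t, hts⟩ ⟨x, hx⟩))

theorem stmt2 (T : SimpleGraph V) (hT : T.IsTree)
    (H : Finset (Finset V)) (htrees : ∀ s ∈ H, IsSubtree T s) :
    matchingWidth H = width H := by
  obtain ⟨le, hrefl, htr, hanti, hch, hadj⟩ := exists_tree_order T hT
  have hH : ∀ s ∈ H, ∃ t, TopOf le t s := fun s hs =>
    subtree_top T le hrefl htr hanti hadj s (htrees s hs)
  have hself : ∀ M ⊆ H, Covers H M := by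
    intro M hM e he
    exact ⟨e, hM he, by rw [Finset.inter_self]; exact (htrees e (hM he)).1⟩
  have hatt : ∀ M ⊆ H, ∃ C ⊆ H, Covers C M ∧ C.card = coverNum M H := by
    intro M hM
    exact Nat.sInf_mem (s := {n | ∃ C ⊆ H, Covers C M ∧ C.card = n})
      ⟨H.card, H, subset_rfl, hself M hM, rfl⟩
  have hle : ∀ M, ∀ C ⊆ H, Covers C M → coverNum M H ≤ C.card :=
    fun M C hC hCM => Nat.sInf_le ⟨C, hC, hCM, rfl⟩
  have hub : ∀ M ⊆ H, coverNum M H ≤ width H := by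
    intro M hM
    obtain ⟨C, hC, hCc, hCn⟩ := hatt H subset_rfl
    unfold width
    rw [← hCn]
    exact hle M C hC (fun e he => hCc e (hM he))
  let S : Set (Finset (Finset V)) := {A | A ⊆ H ∧ ∀ C ⊆ H, Covers C A → width H ≤ C.card}
  have hSne : S.Nonempty := ⟨H, subset_rfl, fun C hC hCH => hle H C hC hCH⟩
  obtain ⟨A, hA⟩ := (Set.toFinite S).exists_minimal hSne
  have hAm : IsHypMatching A := by
    refine minimal_isMatching le hrefl htr hanti hch H hH A hA.1.1 (width H) hA.1.2 ?_
    intro x hx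
    by_contra hcon
    push Not at hcon
    have hmem : A.erase x ∈ S := ⟨(Finset.erase_subset _ _).trans hA.1.1, hcon⟩
    have := hA.2 hmem (Finset.erase_subset _ _) hx
    simp at this
  have hAeq : coverNum A H = width H := by
    refine le_antisymm (hub A hA.1.1) ?_
    obtain ⟨C, hC, hCc, hCn⟩ := hatt A hA.1.1
    rw [← hCn]
    exact hA.1.2 C hC hCc
  have hbound : ∀ n ∈ {n | ∃ M ⊆ H, IsHypMatching M ∧ coverNum M H = n}, n ≤ width H := by
    rintro n ⟨M, hM, _, rfl⟩
    exact hub M hM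
  unfold matchingWidth
  apply le_antisymm
  · exact csSup_le ⟨_, A, hA.1.1, hAm, rfl⟩ hbound
  · exact le_csSup ⟨width H, hbound⟩ ⟨A, hA.1.1, hAm, hAeq⟩
end

section
/- Let H be a family of subtrees of a fixed tree T. Then the independent matching width of H equals the independent width of H: imw(H) = iw(H). -/
variable {V : Type*} [Fintype V] [DecidableEq V]

/-- Minimal size of a matching in `H` covering `H'`. -/
noncomputable def indCoverNum (H' H : Finset (Finset V)) : ℕ :=
  sInf {n | ∃ C ⊆ H, IsHypMatching C ∧ Covers C H' ∧ C.card = n}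

/-- The independent width `iw(H)`. -/
noncomputable def indWidth (H : Finset (Finset V)) : ℕ := indCoverNum H H

/-- The independent matching width `imw(H)`. -/
noncomputable def indMatchingWidth (H : Finset (Finset V)) : ℕ :=
  sSup {n | ∃ M ⊆ H, IsHypMatching M ∧ indCoverNum M H = n}

section core
variable {α : Type*} [DecidableEq α]

/-- Chordal min-max for independent domination with weights. -/
theorem core_minmax (R : α → α → Prop) (symm : ∀ x y, R x y → R y x) (H : Finset α)
    (refl : ∀ x ∈ H, R x x)
    (hs : ∀ U ⊆ H, U.Nonempty → ∃ v ∈ U, ∀ a ∈ U, ∀ b ∈ U, R v a → R v b → R a b) :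
    ∀ U ⊆ H, ∀ A ⊆ U, ∀ w : α → ℤ, (∀ a ∈ A, w a ≤ 1) →
      ∃ I ⊆ A, (∀ x ∈ I, ∀ y ∈ I, R x y → x = y) ∧
      ∃ J ⊆ U, (∀ x ∈ J, ∀ y ∈ J, R x y → x = y) ∧ (∀ a ∈ A, ∃ c ∈ J, R a c) ∧
        ∀ K ⊆ U, (∀ x ∈ K, ∀ y ∈ K, R x y → x = y) → (∀ a ∈ I, ∃ c ∈ K, R a c) →
          ∑ x ∈ J, w x ≤ ∑ x ∈ K, w x := by
  classical
  intro U
  induction U using Finset.strongInduction with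
  | H U ih =>
  intro hU A hA w hw
  rcases U.eq_empty_or_nonempty with rfl | hne
  · obtain rfl := Finset.subset_empty.1 hA
    refine ⟨∅, by simp, by simp, ∅, by simp, by simp, by simp, ?_⟩
    intro K hK _ _
    rw [Finset.subset_empty.1 hK]
  obtain ⟨v, hv, hsim⟩ := hs U hU hne
  have hvv : R v v := refl v (hU hv)
  have hss : U.erase v ⊂ U := Finset.erase_ssubset hv
  have hUe : U.erase v ⊆ H := hss.1.trans hU
  by_cases hcase : w v ≤ 0 ∨ v ∈ A
  · -- shift the weights on the closed neighbourhood of `v`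
    have hw1 : w v ≤ 1 := by
      rcases hcase with h | h
      · omega
      · exact hw v h
    set w' : α → ℤ := fun x => w x - if R v x then w v else 0 with hw'
    have hsum : ∀ K : Finset α, ∑ x ∈ K, w x
        = ∑ x ∈ K, w' x + w v * (K.filter (R v)).card := by
      intro K
      have : ∑ x ∈ K, (if R v x then w v else 0) = w v * (K.filter (R v)).card := by
        rw [← Finset.sum_filter, Finset.sum_const, nsmul_eq_mul, mul_comm]
      rw [← this, ← Finset.sum_add_distrib]
      apply Finset.sum_congr rfl
      intro x _
      simp [hw']
    have hw'v : w' v = 0 := by simp [hw', hvv]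
    have hA' : A.filter (fun x => ¬ R v x) ⊆ U.erase v := by
      intro x hx
      rw [Finset.mem_filter] at hx
      refine Finset.mem_erase.2 ⟨?_, hA hx.1⟩
      rintro rfl
      exact hx.2 hvv
    obtain ⟨I, hIA, hI, J, hJU, hJ, hJA, hmin⟩ := ih _ hss hUe _ hA' w' (by
      intro a ha
      rw [Finset.mem_filter] at ha
      simp only [hw', if_neg ha.2]
      have := hw a ha.1
      omega)
    have hIv : ∀ x ∈ I, x ∈ A ∧ ¬ R v x := fun x hx => by
      simpa using hIA hx
    -- the new covering set
    have hJ' : ∃ J' ⊆ U, (∀ x ∈ J', ∀ y ∈ J', R x y → x = y) ∧ J ⊆ J' ∧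
        (∃ c ∈ J', R v c) ∧ ∑ x ∈ J', w' x = ∑ x ∈ J, w' x := by
      by_cases h : ∃ c ∈ J, R v c
      · exact ⟨J, hJU.trans hss.1, hJ, subset_rfl, h, rfl⟩
      · push Not at h
        refine ⟨insert v J, ?_, ?_, Finset.subset_insert _ _, ⟨v, by simp, hvv⟩, ?_⟩
        · exact Finset.insert_subset hv (hJU.trans hss.1)
        · intro x hx y hy hxy
          rw [Finset.mem_insert] at hx hy
          rcases hx with rfl | hx <;> rcases hy with rfl | hy
          · rfl
          · exact absurd hxy (h _ hy)
          · exact absurd (symm _ _ hxy) (h _ hx)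
          · exact hJ _ hx _ hy hxy
        · rw [Finset.sum_insert (fun hvJ => h v hvJ hvv), hw'v, zero_add]
    obtain ⟨J', hJ'U, hJ'ind, hJJ', ⟨c, hc, hvc⟩, hJ'w⟩ := hJ'
    have hcardle : ∀ K ⊆ U, (∀ x ∈ K, ∀ y ∈ K, R x y → x = y) →
        (K.filter (R v)).card ≤ 1 := by
      intro K hK hKi
      rw [Finset.card_le_one]
      intro a ha b hb
      rw [Finset.mem_filter] at ha hb
      exact hKi a ha.1 b hb.1 (hsim a (hK ha.1) b (hK hb.1) ha.2 hb.2)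
    have hJ'card : (J'.filter (R v)).card = 1 := by
      apply le_antisymm (hcardle _ hJ'U hJ'ind)
      exact Finset.card_pos.2 ⟨c, by simp [hc, hvc]⟩
    have hdomJ' : ∀ a ∈ A, ∃ c ∈ J', R a c := by
      intro a ha
      by_cases hva : R v a
      · exact ⟨c, hc, hsim a (hA ha) c (hJ'U hc) hva hvc⟩
      · obtain ⟨d, hd, had⟩ := hJA a (by simp [ha, hva])
        exact ⟨d, hJJ' hd, had⟩
    have hJ'tot : ∑ x ∈ J', w x = ∑ x ∈ J, w' x + w v := by
      rw [hsum, hJ'card, hJ'w]; simp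
    have key : ∀ K ⊆ U, (∀ x ∈ K, ∀ y ∈ K, R x y → x = y) → (∀ a ∈ I, ∃ c ∈ K, R a c) →
        ∑ x ∈ J, w' x ≤ ∑ x ∈ K, w' x := by
      intro K hK hKi hKd
      have h1 := hmin (K.erase v) (Finset.erase_subset_erase v hK)
        (fun x hx y hy => hKi x (Finset.mem_of_mem_erase hx) y (Finset.mem_of_mem_erase hy))
        (by
          intro a ha
          obtain ⟨d, hd, had⟩ := hKd a ha
          refine ⟨d, Finset.mem_erase.2 ⟨?_, hd⟩, had⟩
          rintro rfl
          exact (hIv a ha).2 (symm _ _ had))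
      rwa [Finset.sum_erase _ hw'v] at h1
    by_cases hc0 : w v ≤ 0
    · refine ⟨I, fun x hx => (hIv x hx).1, hI, J', hJ'U, hJ'ind, hdomJ', ?_⟩
      intro K hK hKi hKd
      have h1 := key K hK hKi hKd
      have h2 : ((K.filter (R v)).card : ℤ) ≤ 1 := by exact_mod_cast hcardle K hK hKi
      rw [hJ'tot, hsum K]
      nlinarith
    · have hvA : v ∈ A := by tauto
      have hwv : w v = 1 := by omega
      refine ⟨insert v I, ?_, ?_, J', hJ'U, hJ'ind, hdomJ', ?_⟩
      · exact Finset.insert_subset hvA (fun x hx => (hIv x hx).1)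
      · intro x hx y hy hxy
        rw [Finset.mem_insert] at hx hy
        rcases hx with rfl | hx <;> rcases hy with rfl | hy
        · rfl
        · exact absurd hxy (hIv _ hy).2
        · exact absurd (symm _ _ hxy) (hIv _ hx).2
        · exact hI _ hx _ hy hxy
      · intro K hK hKi hKd
        have h1 := key K hK hKi (fun a ha => hKd a (Finset.mem_insert_of_mem ha))
        obtain ⟨d, hd, hvd⟩ := hKd v (Finset.mem_insert_self _ _)
        have h2 : 1 ≤ (K.filter (R v)).card := Finset.card_pos.2 ⟨d, by simp [hd, hvd]⟩
        have h3 : (1 : ℤ) ≤ (K.filter (R v)).card := by exact_mod_cast h2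
        rw [hJ'tot, hsum K, hwv]
        linarith
  · -- `v` is never needed: delete it
    push Not at hcase
    obtain ⟨hwv, hvA⟩ := hcase
    have hA' : A ⊆ U.erase v := fun x hx =>
      Finset.mem_erase.2 ⟨fun h => hvA (h ▸ hx), hA hx⟩
    obtain ⟨I, hIA, hI, J, hJU, hJ, hJA, hmin⟩ := ih _ hss hUe A hA' w hw
    refine ⟨I, hIA, hI, J, hJU.trans hss.1, hJ, hJA, ?_⟩
    intro K hK hKi hKd
    have hKe : K.erase v ⊆ U.erase v := Finset.erase_subset_erase v hK
    have hKei : ∀ x ∈ K.erase v, ∀ y ∈ K.erase v, R x y → x = y := fun x hx y hy =>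
      hKi x (Finset.mem_of_mem_erase hx) y (Finset.mem_of_mem_erase hy)
    by_cases hvK : v ∈ K
    · have hsumK : ∑ x ∈ K, w x = w v + ∑ x ∈ K.erase v, w x :=
        (Finset.add_sum_erase K w hvK).symm
      by_cases hd : ∀ a ∈ I, ∃ c ∈ K.erase v, R a c
      · have := hmin _ hKe hKei hd
        linarith
      · push Not at hd
        obtain ⟨u, hu, hun⟩ := hd
        have huA := hIA hu
        have huU := hA huA
        have huv : R v u := by
          obtain ⟨d, hd, hud⟩ := hKd u hu
          by_cases hdv : d = v
          · subst hdv; exact symm _ _ hud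
          · exact absurd hud (hun d (Finset.mem_erase.2 ⟨hdv, hd⟩))
        have huK : u ∉ K.erase v := fun h => hun u h (refl u (hU huU))
        have h1 := hmin (insert u (K.erase v)) (Finset.insert_subset (hA' huA) hKe)
          (by
            intro x hx y hy hxy
            rw [Finset.mem_insert] at hx hy
            rcases hx with rfl | hx <;> rcases hy with rfl | hy
            · rfl
            · exact absurd hxy (hun _ hy)
            · exact absurd (symm _ _ hxy) (hun _ hx)
            · exact hKei _ hx _ hy hxy)
          (by
            intro a ha
            obtain ⟨d, hd, had⟩ := hKd a ha
            by_cases hdv : d = v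
            · subst hdv
              exact ⟨u, Finset.mem_insert_self _ _,
                hsim a (hA (hIA ha)) u huU (symm _ _ had) huv⟩
            · exact ⟨d, Finset.mem_insert_of_mem (Finset.mem_erase.2 ⟨hdv, hd⟩), had⟩)
        rw [Finset.sum_insert huK] at h1
        have := hw u huA
        linarith
    · rw [Finset.erase_eq_of_notMem hvK] at hKe
      exact hmin K hKe hKi hKd

end core

theorem path_sub {V : Type*} (T : SimpleGraph V) (hT : T.IsTree) (s : Set V)
    (hs : (T.induce s).Connected) {x y : V} (hx : x ∈ s) (hy : y ∈ s)
    (p : T.Walk x y) (hp : p.IsPath) : ∀ z ∈ p.support, z ∈ s := by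
  obtain ⟨q, hq⟩ := (hs.preconnected ⟨x, hx⟩ ⟨y, hy⟩).exists_isPath
  let q' : T.Walk x y := q.map (SimpleGraph.Embedding.induce s).toHom
  have hq' : q'.IsPath :=
    SimpleGraph.Walk.IsPath.map (SimpleGraph.Embedding.induce (G := T) s).injective hq
  have : p = q' := (hT.existsUnique_path x y).unique hp hq'
  subst this
  intro z hz
  have hsup : q'.support = q.support.map (SimpleGraph.Embedding.induce (G := T) s).toHom :=
    SimpleGraph.Walk.support_map _ _
  rw [hsup, List.mem_map] at hz
  obtain ⟨a, _, rfl⟩ := hz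
  exact a.2

theorem path_length {V : Type*} (T : SimpleGraph V) (hT : T.IsTree) {x y : V}
    (p : T.Walk x y) (hp : p.IsPath) : p.length = T.dist x y := by
  obtain ⟨q, hq, hl⟩ := hT.connected.exists_path_of_dist x y
  rw [(hT.existsUnique_path x y).unique hp hq, hl]

theorem top_mem {V : Type*} [DecidableEq V] (T : SimpleGraph V) (hT : T.IsTree) (s : Set V)
    (hs : (T.induce s).Connected) (r t x : V) (ht : t ∈ s) (hx : x ∈ s)
    (hmin : ∀ y ∈ s, T.dist r t ≤ T.dist r y) (p : T.Walk r x) (hp : p.IsPath) :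
    t ∈ p.support := by
  obtain ⟨q, hq, hl⟩ := hT.connected.exists_path_of_dist r t
  obtain ⟨q', hq', -⟩ := hT.connected.exists_path_of_dist t x
  have hdis : ∀ z ∈ q.support, z ∈ q'.support → z = t := by
    intro z hz hz'
    have hzs := path_sub T hT s hs ht hx q' hq' z hz'
    by_contra hne
    have h1 := SimpleGraph.Walk.length_takeUntil_lt_length hz hne
    have h2 := SimpleGraph.dist_le (q.takeUntil z hz)
    have := hmin z hzs
    omega
  have happ : (q.append q').IsPath := by
    have hn := hq'.support_nodup
    rw [← SimpleGraph.Walk.cons_tail_support, List.nodup_cons] at hn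
    rw [SimpleGraph.Walk.isPath_def, SimpleGraph.Walk.support_append, List.nodup_append]
    refine ⟨hq.support_nodup, hn.2, ?_⟩
    rintro a ha b hb rfl
    have := hdis a ha (List.mem_of_mem_tail hb)
    subst this
    exact hn.1 hb
  rw [(hT.existsUnique_path r x).unique hp happ]
  simp

theorem simplicial {V : Type*} [Fintype V] [DecidableEq V] (T : SimpleGraph V) (hT : T.IsTree)
    (U : Finset (Finset V)) (hne : U.Nonempty) (htrees : ∀ s ∈ U, IsSubtree T s) :
    ∃ v ∈ U, ∀ a ∈ U, ∀ b ∈ U, (v ∩ a).Nonempty → (v ∩ b).Nonempty → (a ∩ b).Nonempty := by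
  classical
  obtain ⟨r⟩ := hT.connected.nonempty
  have htop : ∀ s : Finset V, ∃ t, s ∈ U → t ∈ s ∧ ∀ y ∈ s, T.dist r t ≤ T.dist r y := by
    intro s
    by_cases h : s ∈ U
    · obtain ⟨t, ht, ht'⟩ := s.exists_min_image (T.dist r) (htrees s h).1
      exact ⟨t, fun _ => ⟨ht, ht'⟩⟩
    · exact ⟨r, fun h' => absurd h' h⟩
  choose top htop using htop
  obtain ⟨v, hv, hvmax⟩ := U.exists_max_image (fun s => T.dist r (top s)) hne
  have main : ∀ a ∈ U, (v ∩ a).Nonempty → top v ∈ a := by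
    rintro a ha ⟨x, hx⟩
    rw [Finset.mem_inter] at hx
    obtain ⟨p, hp, -⟩ := hT.connected.exists_path_of_dist r x
    have h1 := top_mem T hT v (htrees v hv).2 r (top v) x (htop v hv).1 hx.1 (htop v hv).2 p hp
    have h2 := top_mem T hT a (htrees a ha).2 r (top a) x (htop a ha).1 hx.2 (htop a ha).2 p hp
    have h3 : top v ∈ ((p.takeUntil _ h2).append (p.dropUntil _ h2)).support := by
      rw [p.take_spec h2]; exact h1
    rw [SimpleGraph.Walk.mem_support_append_iff] at h3
    rcases h3 with h3 | h3
    · by_cases he : top v = top a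
      · rw [he]; exact (htop a ha).1
      have h4 := SimpleGraph.Walk.length_takeUntil_lt_length h3 he
      have h5 := SimpleGraph.dist_le ((p.takeUntil _ h2).takeUntil _ h3)
      have h6 := path_length T hT _ (hp.takeUntil h2)
      have h7 := hvmax a ha
      omega
    · exact path_sub T hT a (htrees a ha).2 (htop a ha).1 hx.2 _ (hp.dropUntil h2) _ h3
  exact ⟨v, hv, fun a ha b hb h1 h2 =>
    ⟨top v, Finset.mem_inter.2 ⟨main a ha h1, main b hb h2⟩⟩⟩

theorem stmt3 (T : SimpleGraph V) (hT : T.IsTree)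
    (H : Finset (Finset V)) (htrees : ∀ s ∈ H, IsSubtree T s) :
    indMatchingWidth H = indWidth H := by
  have hind : ∀ M : Finset (Finset V),
      IsHypMatching M ↔ ∀ x ∈ M, ∀ y ∈ M, (x ∩ y).Nonempty → x = y := by
    intro M
    unfold IsHypMatching
    refine forall₄_congr fun x _ y _ => ?_
    rw [Finset.disjoint_iff_inter_eq_empty, Finset.nonempty_iff_ne_empty]
    tauto
  obtain ⟨I, hIH, hI, J, hJH, hJ, hJA, hmin⟩ := core_minmax
    (fun x y : Finset V => (x ∩ y).Nonempty) (fun x y h => by rwa [Finset.inter_comm]) H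
    (fun x hx => by simpa using (htrees x hx).1)
    (fun U hU hne => simplicial T hT U hne (fun s hs => htrees s (hU hs)))
    H subset_rfl H subset_rfl (fun _ => 1) (by simp)
  have hle : ∀ M ⊆ H, indCoverNum M H ≤ indWidth H := by
    intro M hM
    have hne : {n | ∃ C ⊆ H, IsHypMatching C ∧ Covers C H ∧ C.card = n}.Nonempty :=
      ⟨_, J, hJH, (hind J).2 hJ, hJA, rfl⟩
    obtain ⟨C, hC, hCm, hCc, hn⟩ := Nat.sInf_mem hne
    exact Nat.sInf_le ⟨C, hC, hCm, fun e he => hCc e (hM he), hn⟩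
  have hge : indWidth H ≤ indCoverNum I H := by
    have hne : {n | ∃ C ⊆ H, IsHypMatching C ∧ Covers C I ∧ C.card = n}.Nonempty :=
      ⟨_, J, hJH, (hind J).2 hJ, fun e he => hJA e (hIH he), rfl⟩
    obtain ⟨C, hC, hCm, hCc, hn⟩ := Nat.sInf_mem hne
    have h1 : indWidth H ≤ J.card := Nat.sInf_le ⟨J, hJH, (hind J).2 hJ, hJA, rfl⟩
    have h2 := hmin C hC ((hind C).1 hCm) hCc
    simp only [Finset.sum_const, nsmul_eq_mul, mul_one, Nat.cast_le] at h2
    change indWidth H ≤ sInf _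
    rw [← hn]
    exact h1.trans h2
  apply le_antisymm
  · apply csSup_le'
    rintro n ⟨M, hM, -, rfl⟩
    exact hle M hM
  · refine hge.trans (le_csSup ⟨indWidth H, ?_⟩ ⟨I, hIH, (hind I).2 hI, rfl⟩)
    rintro n ⟨M, hM, -, rfl⟩
    exact hle M hM
end

section
/- For every finite family F of closed intervals on the real line, the maximum size of a 2-remote subset of F equals the minimum size of an F-covering subset of F. -/
/-- The closed interval associated to a pair. -/
def Iv (p : ℝ × ℝ) : Set ℝ := Set.Icc p.1 p.2

/-- Two intervals meet (intersect). -/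
def Meets (p q : ℝ × ℝ) : Prop := (Iv p ∩ Iv q).Nonempty

/-- `C` covers `F`: every interval of `F` meets some interval of `C`. -/
def IntCovers (C F : Finset (ℝ × ℝ)) : Prop := ∀ p ∈ F, ∃ q ∈ C, Meets p q

/-- `R` is 2-remote in `F`: pairwise disjoint and no interval of `F`
meets two distinct members of `R`. -/
def TwoRemote (F R : Finset (ℝ × ℝ)) : Prop :=
  (∀ p ∈ R, ∀ q ∈ R, p ≠ q → ¬ Meets p q) ∧
  ∀ e ∈ F, ∀ p ∈ R, ∀ q ∈ R, p ≠ q → ¬ (Meets e p ∧ Meets e q)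

/-- `ζ₂(F)`: maximum size of a 2-remote subset of `F`. -/
noncomputable def zeta2 (F : Finset (ℝ × ℝ)) : ℕ :=
  sSup {n | ∃ R ⊆ F, TwoRemote F R ∧ R.card = n}

/-- The width `w(F)`: minimal size of a subset of `F` covering `F`. -/
noncomputable def intWidth (F : Finset (ℝ × ℝ)) : ℕ :=
  sInf {n | ∃ C ⊆ F, IntCovers C F ∧ C.card = n}

theorem meets_iff {p q : ℝ × ℝ} (hp : p.1 ≤ p.2) (hq : q.1 ≤ q.2) :
    Meets p q ↔ p.1 ≤ q.2 ∧ q.1 ≤ p.2 := by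
  unfold Meets Iv
  rw [Set.Icc_inter_Icc, Set.nonempty_Icc, sup_le_iff, le_inf_iff, le_inf_iff]
  tauto

theorem remote_le_cover {F R C : Finset (ℝ × ℝ)} (hR : R ⊆ F) (hC : C ⊆ F)
    (h2 : TwoRemote F R) (hc : IntCovers C F) : R.card ≤ C.card := by
  have h : ∀ p : ℝ × ℝ, ∃ q, p ∈ R → q ∈ C ∧ Meets p q := by
    intro p
    by_cases hp : p ∈ R
    · obtain ⟨q, hq⟩ := hc p (hR hp)
      exact ⟨q, fun _ => hq⟩
    · exact ⟨p, fun h => absurd h hp⟩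
  choose f hf using h
  refine Finset.card_le_card_of_injOn f (fun p hp => (hf p hp).1) ?_
  intro p hp q hq hpq
  by_contra hne
  have h1 := (hf p hp).2
  have h3 := (hf q hq).2
  rw [← hpq] at h3
  refine h2.2 (f p) (hC (hf p hp).1) p hp q hq hne ⟨?_, ?_⟩
  · unfold Meets at *; rwa [Set.inter_comm]
  · unfold Meets at *; rwa [Set.inter_comm]

theorem greedy (F : Finset (ℝ × ℝ)) (hF : ∀ p ∈ F, p.1 ≤ p.2) (U : Finset (ℝ × ℝ)) :
    U ⊆ F → ∃ R C : Finset (ℝ × ℝ), R ⊆ U ∧ C ⊆ F ∧ IntCovers C U ∧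
      (∀ e ∈ F, ∀ p ∈ R, ∀ q ∈ R, p ≠ q → ¬ (Meets e p ∧ Meets e q)) ∧ C.card ≤ R.card := by
  classical
  induction U using Finset.strongInduction with
  | H U ih =>
  intro hU
  rcases U.eq_empty_or_nonempty with rfl | hne
  · exact ⟨∅, ∅, by simp, by simp, by simp [IntCovers], by simp, by simp⟩
  obtain ⟨p, hpU, hp⟩ := U.exists_min_image (fun x => x.2) hne
  have hpF := hU hpU
  have hpp : Meets p p := (meets_iff (hF p hpF) (hF p hpF)).2 ⟨hF p hpF, hF p hpF⟩
  obtain ⟨q, hq, hqm⟩ := (F.filter (fun x => Meets p x)).exists_max_image (fun x => x.2)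
    ⟨p, by simp [hpF, hpp]⟩
  obtain ⟨hqF, hpq⟩ := Finset.mem_filter.1 hq
  have hpq' := (meets_iff (hF p hpF) (hF q hqF)).1 hpq
  obtain ⟨R, C, hRU, hCF, hcov, hrem, hcard⟩ := ih (U.filter (fun x => ¬ Meets x q))
    (Finset.filter_ssubset.2 ⟨p, hpU, by simpa using hpq⟩)
    ((Finset.filter_subset _ _).trans hU)
  have key : ∀ e ∈ F, ∀ r ∈ R, ¬ (Meets e p ∧ Meets e r) := by
    rintro e he r hr ⟨h1, h2⟩
    obtain ⟨hrU, hrq⟩ := Finset.mem_filter.1 (hRU hr)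
    have hrF := hU hrU
    rw [meets_iff (hF r hrF) (hF q hqF)] at hrq
    rw [meets_iff (hF e he) (hF p hpF)] at h1
    rw [meets_iff (hF e he) (hF r hrF)] at h2
    have h3 := hqm e (by
      simp only [Finset.mem_filter]
      exact ⟨he, (meets_iff (hF p hpF) (hF e he)).2 ⟨h1.2, h1.1⟩⟩)
    have h4 := hp r hrU
    exact hrq ⟨by linarith [h2.2], by linarith [hpq'.2]⟩
  have hpR : p ∉ R := fun h => (Finset.mem_filter.1 (hRU h)).2 hpq
  refine ⟨insert p R, insert q C, ?_, ?_, ?_, ?_, ?_⟩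
  · exact Finset.insert_subset hpU (hRU.trans (Finset.filter_subset _ _))
  · exact Finset.insert_subset hqF hCF
  · intro x hx
    by_cases h : Meets x q
    · exact ⟨q, by simp, h⟩
    · obtain ⟨c, hc, hm⟩ := hcov x (Finset.mem_filter.2 ⟨hx, h⟩)
      exact ⟨c, by simp [hc], hm⟩
  · intro e he a ha b hb hab h
    rcases Finset.mem_insert.1 ha with rfl | ha2
    · rcases Finset.mem_insert.1 hb with rfl | hb2
      · exact hab rfl
      · exact key e he b hb2 h
    · rcases Finset.mem_insert.1 hb with rfl | hb2
      · exact key e he a ha2 h.symm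
      · exact hrem e he a ha2 b hb2 hab h
  · rw [Finset.card_insert_of_notMem hpR]
    exact (Finset.card_insert_le _ _).trans (by omega)

theorem stmt5 (F : Finset (ℝ × ℝ)) (hF : ∀ p ∈ F, p.1 ≤ p.2) :
    zeta2 F = intWidth F := by
  obtain ⟨R, C, hR, hC, hcov, hrem, hcard⟩ := greedy F hF F subset_rfl
  have h2 : TwoRemote F R := by
    refine ⟨fun p hp q hq hne hm => hrem p (hR hp) p hp q hq hne ⟨?_, hm⟩, hrem⟩
    have := hF p (hR hp)
    exact (meets_iff this this).2 ⟨this, this⟩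
  have heq : R.card = C.card := le_antisymm (remote_le_cover hR hC h2 hcov) hcard
  have hz : zeta2 F = R.card := by
    refine IsGreatest.csSup_eq ⟨⟨R, hR, h2, rfl⟩, ?_⟩
    rintro n ⟨R', hR', h2', rfl⟩
    rw [heq]
    exact remote_le_cover hR' hC h2' hcov
  have hw : intWidth F = C.card := by
    refine IsLeast.csInf_eq ⟨⟨C, hC, hcov, rfl⟩, ?_⟩
    rintro n ⟨C', hC', hc', rfl⟩
    rw [← heq]
    exact remote_le_cover hR hC' h2 hc'
  rw [hz, hw, heq]
end
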